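/- At every z ∈ ℝ^d with ‖z‖₂ ∉ {0, ε, 2ε}, the function f is three times differentiable and the operator norm of its third derivative satisfies ‖∇³f(z)‖ ≤ 9/ε²; moreover, for every z ∈ ℝ^d, (1/2)·exp(−7α𝓡²/3)·(‖z‖₂ − 2ε) ≤ f(z) ≤ ‖z‖₂. -/

import Mathlib

open MeasureTheory Real

/-- The concave reweighting function τ from the Eberle-type construction. -/
noncomputable def tau (R r : ℝ) : ℝ :=
  if r ≤ R then r ^ 2 / 2
  else if r ≤ 2 * R then
    R ^ 2 / 2 + R * (r - R) + (r - R) ^ 2 / 2 - (r - R) ^ 3 / (3 * R)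
  else if r ≤ 4 * R then
    5 * R ^ 2 / 3 + R * (r - 2 * R) - (r - 2 * R) ^ 2 / 2 + (r - 2 * R) ^ 3 / (12 * R)
  else 7 * R ^ 2 / 3

/-- The cutoff function μ. -/
noncomputable def muf (R r : ℝ) : ℝ :=
  if r ≤ R then 1
  else if r ≤ 4 * R then 1 / 2 + 1 / 2 * Real.cos (Real.pi * (r - R) / (3 * R))
  else 0

/-- ψ(r) = exp(−α τ(r)). -/
noncomputable def psi (α R r : ℝ) : ℝ := Real.exp (-(α * tau R r))

/-- Ψ(r) = ∫₀ʳ ψ(s) ds. -/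
noncomputable def PsiInt (α R r : ℝ) : ℝ := ∫ s in (0:ℝ)..r, psi α R s

/-- ν(r) = 1 − (1/2) (∫₀ʳ μΨ/ψ) / (∫₀^{4R} μΨ/ψ). -/
noncomputable def nuf (α R r : ℝ) : ℝ :=
  1 - (1 / 2) * (∫ s in (0:ℝ)..r, muf R s * PsiInt α R s / psi α R s) /
      (∫ s in (0:ℝ)..(4 * R), muf R s * PsiInt α R s / psi α R s)

/-- q(r) = ∫₀ʳ ψ(s) ν(s) ds. -/
noncomputable def qf (α R r : ℝ) : ℝ := ∫ s in (0:ℝ)..r, psi α R s * nuf α R s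

/-- The smoothed norm profile h. -/
noncomputable def hfun (ε r : ℝ) : ℝ :=
  if r ≤ ε then r ^ 3 / (6 * ε ^ 2)
  else if r ≤ 2 * ε then
    ε / 6 + (r - ε) / 2 + (r - ε) ^ 2 / (2 * ε) - (r - ε) ^ 3 / (6 * ε ^ 2)
  else r

/-- g(z) = h(‖z‖₂) on ℝ^d. -/
noncomputable def gfun (ε : ℝ) {d : ℕ} (z : EuclideanSpace ℝ (Fin d)) : ℝ := hfun ε ‖z‖

/-- The Lyapunov function f(z) = q(g(z)). -/
noncomputable def ffun (α R ε : ℝ) {d : ℕ} (z : EuclideanSpace ℝ (Fin d)) : ℝ :=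
  qf α R (gfun ε z)

/-- Two differentiable functions that agree to first order at `a` glue to a differentiable one. -/
lemma hasDerivAt_ite_le {F G F' G' : ℝ → ℝ} {a : ℝ} (hF : ∀ r, HasDerivAt F (F' r) r)
    (hG : ∀ r, HasDerivAt G (G' r) r) (h0 : F a = G a) (h1 : F' a = G' a) (r : ℝ) :
    HasDerivAt (fun s => if s ≤ a then F s else G s) (if r ≤ a then F' r else G' r) r := by
  rcases lt_trichotomy r a with h | h | h
  · rw [if_pos h.le]
    refine (hF r).congr_of_eventuallyEq ?_
    filter_upwards [Iio_mem_nhds h] with s hs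
    rw [if_pos (le_of_lt hs)]
  · subst h
    rw [if_pos le_rfl]
    have hl : HasDerivWithinAt (fun s => if s ≤ r then F s else G s) (F' r) (Set.Iic r) r :=
      (hF r).hasDerivWithinAt.congr (fun s hs => if_pos hs) (if_pos le_rfl)
    have hr : HasDerivWithinAt (fun s => if s ≤ r then F s else G s) (F' r) (Set.Ici r) r := by
      rw [h1]
      refine (hG r).hasDerivWithinAt.congr (fun s hs => ?_) (by simp [h0])
      rcases eq_or_lt_of_le (Set.mem_Ici.1 hs) with e | e
      · subst e; simp [h0]
      · rw [if_neg (not_le.2 e)]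
    have := hl.union hr
    rwa [Set.Iic_union_Ici, hasDerivWithinAt_univ] at this
  · rw [if_neg (not_le.2 h)]
    refine (hG r).congr_of_eventuallyEq ?_
    filter_upwards [Ioi_mem_nhds h] with s hs
    rw [if_neg (not_le.2 hs)]

lemma ContDiff.of_hasDerivAt_succ {n : ℕ} {F F' : ℝ → ℝ} (hF : ∀ r, HasDerivAt F (F' r) r)
    (hF' : ContDiff ℝ n F') : ContDiff ℝ (n + 1) F := by
  rw [contDiff_succ_iff_deriv]
  refine ⟨fun r => (hF r).differentiableAt, by simp, ?_⟩
  rwa [show deriv F = F' from funext fun r => (hF r).deriv]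

section Radial

variable {E : Type*} [NormedAddCommGroup E] [InnerProductSpace ℝ E]

lemma HasDerivAt.hasFDerivAt_comp_norm {P : ℝ → ℝ} {p : ℝ} {y : E} (hy : y ≠ 0)
    (h : HasDerivAt P p ‖y‖) :
    HasFDerivAt (fun x : E => P ‖x‖) ((p / ‖y‖) • innerSL ℝ y) y := by
  have h0 : 0 < ‖y‖ := norm_pos_iff.2 hy
  have h2 : HasFDerivAt (fun x : E => √(‖x‖ ^ 2)) ((1 / (2 * √(‖y‖ ^ 2))) • (2 • innerSL ℝ y)) y :=
    (hasStrictFDerivAt_norm_sq y).hasFDerivAt.sqrt (by positivity)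
  simp only [Real.sqrt_sq (norm_nonneg _)] at h2
  refine (h.comp_hasFDerivAt y h2).congr_fderiv ?_
  ext v
  simp
  field_simp

lemma HasFDerivAt.clm_apply_const {F G : Type*} [NormedAddCommGroup F] [NormedSpace ℝ F]
    [NormedAddCommGroup G] [NormedSpace ℝ G] {A : E → F →L[ℝ] G} {A' : E →L[ℝ] F →L[ℝ] G} {y : E}
    (h : HasFDerivAt A A' y) (v : F) : HasFDerivAt (fun x => A x v) (A'.flip v) y := by
  refine ((ContinuousLinearMap.apply ℝ G v).hasFDerivAt.comp y h).congr_fderiv ?_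
  ext w
  simp

lemma hasFDerivAt_inner_right_const (u y : E) :
    HasFDerivAt (fun x : E => inner ℝ x u) (innerSL ℝ u) y := by
  refine (innerSL ℝ u).hasFDerivAt.congr_of_eventuallyEq (.of_forall fun x => ?_)
  simp [real_inner_comm]

lemma norm_iteratedFDeriv_three_radial_le {Q Q₁ Q₂ Q₃ : ℝ → ℝ}
    (h₁ : ∀ r, HasDerivAt Q (Q₁ r) r) (h₂ : ∀ r, HasDerivAt Q₁ (Q₂ r) r)
    (h₃ : ∀ r, HasDerivAt Q₂ (Q₃ r) r) (hQ : ContDiff ℝ 3 Q) {z : E} (hz : z ≠ 0) :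
    ContDiffAt ℝ 3 (fun y : E => Q ‖y‖) z ∧
    ‖iteratedFDeriv ℝ 3 (fun y : E => Q ‖y‖) z‖ ≤
      |Q₃ ‖z‖| + 6 * |Q₂ ‖z‖ / ‖z‖ - Q₁ ‖z‖ / ‖z‖ ^ 2| := by
  set f : E → ℝ := fun y => Q ‖y‖ with hf
  have hC : ∀ y : E, y ≠ 0 → ContDiffAt ℝ 3 f y := fun y hy =>
    hQ.contDiffAt.comp y (contDiffAt_norm ℝ hy)
  refine ⟨hC z hz, ?_⟩
  have hC1 : ∀ y : E, y ≠ 0 → ContDiffAt ℝ 2 (fderiv ℝ f) y := fun y hy =>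
    (hC y hy).fderiv_right (by norm_num)
  have hC2 : ∀ y : E, y ≠ 0 → ContDiffAt ℝ 1 (fderiv ℝ (fderiv ℝ f)) y := fun y hy =>
    (hC1 y hy).fderiv_right (by norm_num)
  have hne : ∀ y : E, y ≠ 0 → ∀ᶠ x in nhds y, x ≠ 0 := fun y hy => isOpen_ne.mem_nhds hy
  have d1 : ∀ y : E, y ≠ 0 → ∀ u, fderiv ℝ f y u = Q₁ ‖y‖ / ‖y‖ * inner ℝ y u := by
    intro y hy u
    rw [((h₁ ‖y‖).hasFDerivAt_comp_norm hy).fderiv]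
    simp
  have d2 : ∀ y : E, y ≠ 0 → ∀ v u, fderiv ℝ (fderiv ℝ f) y v u =
      Q₁ ‖y‖ / ‖y‖ * inner ℝ v u
        + (Q₂ ‖y‖ / ‖y‖ ^ 2 - Q₁ ‖y‖ / ‖y‖ ^ 3) * (inner ℝ y v * inner ℝ y u) := by
    intro y hy v u
    have hy0 : ‖y‖ ≠ 0 := norm_ne_zero_iff.2 hy
    have e1 := ((hC1 y hy).differentiableAt (by norm_num)).hasFDerivAt.clm_apply_const u
    have e2 := (((h₂ ‖y‖).div (hasDerivAt_id _) hy0).hasFDerivAt_comp_norm hy).mul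
      (hasFDerivAt_inner_right_const u y)
    have e3 := e1.unique (e2.congr_of_eventuallyEq
      ((hne y hy).mono fun x hx => d1 x hx u))
    have e4 := congrArg (fun L => L v) e3
    simp at e4
    rw [e4, real_inner_comm u v]
    field_simp
  have d3 : ∀ w v u, fderiv ℝ (fderiv ℝ (fderiv ℝ f)) z w v u =
      (Q₂ ‖z‖ / ‖z‖ ^ 2 - Q₁ ‖z‖ / ‖z‖ ^ 3) *
        (inner ℝ z w * inner ℝ v u + inner ℝ w v * inner ℝ z u + inner ℝ z v * inner ℝ w u)
      + (Q₃ ‖z‖ / ‖z‖ ^ 3 - 3 * Q₂ ‖z‖ / ‖z‖ ^ 4 + 3 * Q₁ ‖z‖ / ‖z‖ ^ 5) *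
        (inner ℝ z w * inner ℝ z v * inner ℝ z u) := by
    intro w v u
    have hy0 : ‖z‖ ≠ 0 := norm_ne_zero_iff.2 hz
    have e1 := (((hC2 z hz).differentiableAt (by norm_num)).hasFDerivAt.clm_apply_const
      v).clm_apply_const u
    have e2 := ((((h₂ ‖z‖).div (hasDerivAt_id _) hy0).hasFDerivAt_comp_norm hz).mul_const
      (inner ℝ v u)).add
      (((((h₃ ‖z‖).div (hasDerivAt_pow 2 _) (pow_ne_zero 2 hy0)).sub
        ((h₂ ‖z‖).div (hasDerivAt_pow 3 _) (pow_ne_zero 3 hy0))).hasFDerivAt_comp_norm hz).mul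
      ((hasFDerivAt_inner_right_const v z).mul (hasFDerivAt_inner_right_const u z)))
    have e3 := e1.unique (e2.congr_of_eventuallyEq
      ((hne z hz).mono fun x hx => d2 x hx v u))
    have e4 := congrArg (fun L => L w) e3
    simp at e4
    rw [e4, real_inner_comm u w, real_inner_comm v w]
    field_simp
    ring
  have hr : 0 < ‖z‖ := norm_pos_iff.2 hz
  rw [← norm_iteratedFDeriv_fderiv, ← norm_iteratedFDeriv_fderiv, norm_iteratedFDeriv_one]
  set r := ‖z‖ with hrdef
  set b := Q₂ r / r - Q₁ r / r ^ 2 with hb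
  have k1 : Q₂ r / r ^ 2 - Q₁ r / r ^ 3 = b / r := by rw [hb]; field_simp
  have k2 : Q₃ r / r ^ 3 - 3 * Q₂ r / r ^ 4 + 3 * Q₁ r / r ^ 5 = (Q₃ r - 3 * b) / r ^ 3 := by
    rw [hb]; field_simp; ring
  have hK : 0 ≤ |Q₃ r| + 6 * |b| := by positivity
  refine ContinuousLinearMap.opNorm_le_bound _ hK fun w =>
    ContinuousLinearMap.opNorm_le_bound _ (by positivity) fun v =>
    ContinuousLinearMap.opNorm_le_bound _ (by positivity) fun u => ?_
  rw [d3, k1, k2, Real.norm_eq_abs]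
  have cs : ∀ x y : E, |inner ℝ x y| ≤ ‖x‖ * ‖y‖ := abs_real_inner_le_norm
  have hzi : ∀ x : E, |inner ℝ z x| ≤ r * ‖x‖ := fun x => cs z x
  have t1 : |inner ℝ z w * inner ℝ v u + inner ℝ w v * inner ℝ z u + inner ℝ z v * inner ℝ w u| ≤
      3 * (r * (‖w‖ * ‖v‖ * ‖u‖)) := by
    have a1 : |inner ℝ z w * inner ℝ v u| ≤ (r * ‖w‖) * (‖v‖ * ‖u‖) := by
      rw [abs_mul]; gcongr; exacts [hzi w, cs v u]
    have a2 : |inner ℝ w v * inner ℝ z u| ≤ (‖w‖ * ‖v‖) * (r * ‖u‖) := by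
      rw [abs_mul]; gcongr; exacts [cs w v, hzi u]
    have a3 : |inner ℝ z v * inner ℝ w u| ≤ (r * ‖v‖) * (‖w‖ * ‖u‖) := by
      rw [abs_mul]; gcongr; exacts [hzi v, cs w u]
    refine (abs_add_three _ _ _).trans ?_
    linarith
  have t2 : |inner ℝ z w * inner ℝ z v * inner ℝ z u| ≤ r ^ 3 * (‖w‖ * ‖v‖ * ‖u‖) := by
    rw [abs_mul, abs_mul]
    calc _ ≤ (r * ‖w‖) * (r * ‖v‖) * (r * ‖u‖) := by gcongr <;> apply hzi
      _ = _ := by ring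
  refine (abs_add_le _ _).trans ?_
  rw [abs_mul, abs_mul, abs_div, abs_div, abs_of_pos hr, abs_of_pos (pow_pos hr 3)]
  have t3 : |Q₃ r - 3 * b| ≤ |Q₃ r| + 3 * |b| := by
    refine (abs_sub _ _).trans ?_
    rw [abs_mul]; norm_num
  calc _ ≤ |b| / r * (3 * (r * (‖w‖ * ‖v‖ * ‖u‖)))
        + (|Q₃ r| + 3 * |b|) / r ^ 3 * (r ^ 3 * (‖w‖ * ‖v‖ * ‖u‖)) := by gcongr
    _ = _ := by field_simp; ring

end Radial

/-- The first derivative of `tau`. -/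
noncomputable def tauDeriv (R r : ℝ) : ℝ :=
  if r ≤ R then r
  else if r ≤ 2 * R then R + (r - R) - (r - R) ^ 2 / R
  else if r ≤ 4 * R then R - (r - 2 * R) + (r - 2 * R) ^ 2 / (4 * R)
  else 0

/-- The second derivative of `tau`. -/
noncomputable def tauDeriv2 (R r : ℝ) : ℝ :=
  if r ≤ R then 1
  else if r ≤ 2 * R then 1 - 2 * (r - R) / R
  else if r ≤ 4 * R then -1 + (r - 2 * R) / (2 * R)
  else 0

/-- The derivative of `muf`. -/
noncomputable def mufDeriv (R r : ℝ) : ℝ :=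
  if r ≤ R then 0
  else if r ≤ 4 * R then -(π / (6 * R) * sin (π * (r - R) / (3 * R)))
  else 0

section Profile

variable {α R : ℝ}

lemma hasDerivAt_tau (hR : 0 < R) (r : ℝ) : HasDerivAt (tau R) (tauDeriv R r) r := by
  have h12 : R ≤ 2 * R := by linarith
  have h24 : 2 * R ≤ 4 * R := by linarith
  change HasDerivAt (fun s => tau R s) _ r
  unfold tau tauDeriv
  revert r
  refine hasDerivAt_ite_le (fun r => ?_) (hasDerivAt_ite_le (fun r => ?_)
    (hasDerivAt_ite_le (fun r => ?_) (fun r => hasDerivAt_const r (7 * R ^ 2 / 3)) ?_ ?_) ?_ ?_) ?_ ?_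
  · exact ((hasDerivAt_pow 2 r).div_const 2).congr_deriv (by simp)
  · have h := (hasDerivAt_id r).sub_const R
    refine ((((h.const_mul R).const_add (R ^ 2 / 2)).add ((h.pow 2).div_const 2)).sub
      ((h.pow 3).div_const (3 * R))).congr_deriv ?_
    simp
    field_simp
  · have h := (hasDerivAt_id r).sub_const (2 * R)
    refine ((((h.const_mul R).const_add (5 * R ^ 2 / 3)).sub ((h.pow 2).div_const 2)).add
      ((h.pow 3).div_const (12 * R))).congr_deriv ?_
    simp
    field_simp
    ring
  · field_simp; ring
  · field_simp; ring
  · rw [if_pos h24]; field_simp; ring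
  · rw [if_pos h24]; field_simp; ring
  · rw [if_pos h12]; field_simp; ring
  · rw [if_pos h12]; field_simp; ring

lemma hasDerivAt_tauDeriv (hR : 0 < R) (r : ℝ) :
    HasDerivAt (tauDeriv R) (tauDeriv2 R r) r := by
  have h12 : R ≤ 2 * R := by linarith
  have h24 : 2 * R ≤ 4 * R := by linarith
  change HasDerivAt (fun s => tauDeriv R s) _ r
  unfold tauDeriv tauDeriv2
  revert r
  refine hasDerivAt_ite_le (fun r => hasDerivAt_id r) (hasDerivAt_ite_le (fun r => ?_)
    (hasDerivAt_ite_le (fun r => ?_) (fun r => hasDerivAt_const r 0) ?_ ?_) ?_ ?_) ?_ ?_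
  · have h := (hasDerivAt_id r).sub_const R
    refine ((h.const_add R).sub ((h.pow 2).div_const R)).congr_deriv ?_
    simp
  · have h := (hasDerivAt_id r).sub_const (2 * R)
    refine ((h.const_sub R).add ((h.pow 2).div_const (4 * R))).congr_deriv ?_
    simp
    field_simp
    ring
  · field_simp; ring
  · field_simp; ring
  · rw [if_pos h24]; field_simp; ring
  · rw [if_pos h24]; field_simp; ring
  · rw [if_pos h12]; simp
  · rw [if_pos h12]; simp

lemma continuous_tauDeriv2 (hR : 0 < R) : Continuous (tauDeriv2 R) := by
  unfold tauDeriv2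
  refine Continuous.if_le (by fun_prop) (Continuous.if_le (by fun_prop) (Continuous.if_le
    (by fun_prop) (by fun_prop) (by fun_prop) (by fun_prop) ?_) (by fun_prop) (by fun_prop) ?_)
    (by fun_prop) (by fun_prop) ?_
  · rintro x rfl; field_simp; ring
  · rintro x rfl; rw [if_pos (by linarith)]; field_simp; ring
  · rintro x rfl; rw [if_pos (by linarith)]; simp

lemma hasDerivAt_muf (hR : 0 < R) (r : ℝ) : HasDerivAt (muf R) (mufDeriv R r) r := by
  have h14 : R ≤ 4 * R := by linarith
  have hpi : π * (4 * R - R) / (3 * R) = π := by field_simp; ring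
  change HasDerivAt (fun s => muf R s) _ r
  unfold muf mufDeriv
  revert r
  refine hasDerivAt_ite_le (fun r => hasDerivAt_const r 1) (hasDerivAt_ite_le (fun r => ?_)
    (fun r => hasDerivAt_const r 0) ?_ ?_) ?_ ?_
  · have h := (((hasDerivAt_id r).sub_const R).const_mul π).div_const (3 * R)
    refine ((h.cos.const_mul (1 / 2)).const_add (1 / 2)).congr_deriv ?_
    simp
    field_simp
    ring
  · rw [hpi]; simp
  · rw [hpi]; simp
  · rw [if_pos h14]; norm_num
  · rw [if_pos h14]; simp

lemma continuous_mufDeriv (hR : 0 < R) : Continuous (mufDeriv R) := by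
  have hpi : π * (4 * R - R) / (3 * R) = π := by field_simp; ring
  unfold mufDeriv
  refine Continuous.if_le (by fun_prop) (Continuous.if_le (by fun_prop) (by fun_prop)
    (by fun_prop) (by fun_prop) ?_) (by fun_prop) (by fun_prop) ?_
  · rintro x rfl; rw [hpi]; simp
  · rintro x rfl; rw [if_pos (by linarith)]; simp

lemma tauDeriv_nonneg (hR : 0 < R) {r : ℝ} (hr : 0 ≤ r) : 0 ≤ tauDeriv R r := by
  unfold tauDeriv
  split_ifs with h1 h2 h3
  · exact hr
  · have : (r - R) ^ 2 / R ≤ r - R := by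
      rw [div_le_iff₀ hR]; nlinarith
    linarith
  · rw [show R - (r - 2 * R) + (r - 2 * R) ^ 2 / (4 * R) = (r - 4 * R) ^ 2 / (4 * R) by
      field_simp; ring]
    positivity
  · exact le_rfl

lemma tauDeriv_le (hR : 0 < R) (r : ℝ) : tauDeriv R r ≤ 2 * R := by
  unfold tauDeriv
  split_ifs with h1 h2 h3
  · linarith
  · have : 0 ≤ (r - R) ^ 2 / R := by positivity
    linarith
  · have : (r - 2 * R) ^ 2 / (4 * R) ≤ r - 2 * R := by
      rw [div_le_iff₀ (by linarith)]; nlinarith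
    linarith
  · linarith

lemma abs_tauDeriv2_le (hR : 0 < R) (r : ℝ) : |tauDeriv2 R r| ≤ 1 := by
  unfold tauDeriv2
  split_ifs with h1 h2 h3
  · simp
  · have h : 2 * (r - R) / R ≤ 2 := by rw [div_le_iff₀ hR]; linarith
    have h' : 0 ≤ 2 * (r - R) / R := div_nonneg (by linarith) hR.le
    rw [abs_le]; constructor <;> linarith
  · have h : (r - 2 * R) / (2 * R) ≤ 1 := by rw [div_le_iff₀ (by linarith)]; linarith
    have h' : 0 ≤ (r - 2 * R) / (2 * R) := div_nonneg (by linarith) (by linarith)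
    rw [abs_le]; constructor <;> linarith
  · simp

lemma monotoneOn_tau (hR : 0 < R) : MonotoneOn (tau R) (Set.Ici 0) := by
  refine monotoneOn_of_deriv_nonneg (convex_Ici 0)
    (fun r _ => (hasDerivAt_tau hR r).continuousAt.continuousWithinAt)
    (fun r _ => (hasDerivAt_tau hR r).differentiableAt.differentiableWithinAt) fun r hr => ?_
  rw [(hasDerivAt_tau hR r).deriv]
  rw [interior_Ici] at hr
  exact tauDeriv_nonneg hR (le_of_lt hr)

lemma tau_nonneg (hR : 0 < R) {r : ℝ} (hr : 0 ≤ r) : 0 ≤ tau R r := by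
  have h := monotoneOn_tau hR (Set.mem_Ici.2 le_rfl) hr hr
  simpa [tau, hR.le] using h

lemma tau_le (hR : 0 < R) {r : ℝ} (hr : 0 ≤ r) : tau R r ≤ 7 * R ^ 2 / 3 := by
  have h := monotoneOn_tau hR hr (Set.mem_Ici.2 (by positivity : 0 ≤ r + 4 * R + 1)) (by linarith)
  refine h.trans_eq ?_
  unfold tau
  rw [if_neg (by linarith), if_neg (by linarith), if_neg (by linarith)]

lemma muf_nonneg (r : ℝ) : 0 ≤ muf R r := by
  unfold muf
  split_ifs
  · norm_num
  · linarith [neg_one_le_cos (π * (r - R) / (3 * R))]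
  · exact le_rfl

lemma muf_eq_zero (hR : 0 < R) {r : ℝ} (hr : 4 * R ≤ r) : muf R r = 0 := by
  rw [muf, if_neg (by linarith)]
  split_ifs with h
  · rw [show π * (r - R) / (3 * R) = π by rw [le_antisymm h hr]; field_simp; ring, cos_pi]
    norm_num
  · rfl

lemma muf_le_one (r : ℝ) : muf R r ≤ 1 := by
  unfold muf
  split_ifs
  · exact le_rfl
  · linarith [cos_le_one (π * (r - R) / (3 * R))]
  · norm_num

lemma muf_mul_le (hR : 0 < R) {r : ℝ} (hr : 0 ≤ r) : muf R r * r ≤ 2 * R := by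
  rcases le_or_gt r (2 * R) with h2 | h2
  · nlinarith [muf_le_one (R := R) r, muf_nonneg (R := R) r]
  rcases le_or_gt r (4 * R) with h4 | h4
  swap
  · rw [muf, if_neg (by linarith), if_neg (by linarith)]; linarith
  rw [muf, if_neg (by linarith), if_pos h4]
  have hpi := pi_pos
  have hle : π * (r - R) / (3 * R) ≤ π := by
    rw [div_le_iff₀ (by positivity)]; nlinarith
  rcases le_or_gt r (5 * R / 2) with h | h
  · have : cos (π * (r - R) / (3 * R)) ≤ cos (π / 3) := by
      refine cos_le_cos_of_nonneg_of_le_pi (by positivity) hle ?_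
      rw [le_div_iff₀ (by positivity)]; nlinarith
    rw [cos_pi_div_three] at this
    nlinarith
  · have : cos (π * (r - R) / (3 * R)) ≤ cos (π / 2) := by
      refine cos_le_cos_of_nonneg_of_le_pi (by positivity) hle ?_
      rw [le_div_iff₀ (by positivity)]; nlinarith
    rw [cos_pi_div_two] at this
    nlinarith

lemma abs_mufDeriv_le (hR : 0 < R) (r : ℝ) : |mufDeriv R r| ≤ π / (6 * R) := by
  have hpi := pi_pos
  have h0 : 0 ≤ π / (6 * R) := by positivity
  unfold mufDeriv
  split_ifs
  · simpa
  · rw [abs_neg, abs_mul, abs_of_nonneg h0]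
    exact mul_le_of_le_one_right h0 (abs_sin_le_one _)
  · simpa

lemma psi_pos (r : ℝ) : 0 < psi α R r := exp_pos _

lemma hasDerivAt_psi (hR : 0 < R) (r : ℝ) :
    HasDerivAt (psi α R) (-(α * tauDeriv R r) * psi α R r) r :=
  (((hasDerivAt_tau hR r).const_mul α).neg.exp).congr_deriv (by simp [psi]; ring)

lemma continuous_psi (hR : 0 < R) : Continuous (psi α R) :=
  continuous_iff_continuousAt.2 fun r => (hasDerivAt_psi hR r).continuousAt

lemma antitoneOn_psi (hα : 0 < α) (hR : 0 < R) : AntitoneOn (psi α R) (Set.Ici 0) := by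
  intro r hr s hs hrs
  have := monotoneOn_tau hR hr hs hrs
  unfold psi
  gcongr

lemma psi_le_one (hα : 0 < α) (hR : 0 < R) {r : ℝ} (hr : 0 ≤ r) : psi α R r ≤ 1 := by
  have := tau_nonneg hR hr
  exact exp_le_one_iff.2 (by nlinarith)

lemma le_psi (hα : 0 < α) (hR : 0 < R) {r : ℝ} (hr : 0 ≤ r) :
    exp (-(7 * α * R ^ 2 / 3)) ≤ psi α R r := by
  have := tau_le hR hr
  exact exp_le_exp.2 (by nlinarith)

lemma hasDerivAt_PsiInt (hR : 0 < R) (r : ℝ) : HasDerivAt (PsiInt α R) (psi α R r) r :=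
  ((continuous_psi hR).integral_hasStrictDerivAt 0 r).hasDerivAt

lemma PsiInt_nonneg {r : ℝ} (hr : 0 ≤ r) : 0 ≤ PsiInt α R r :=
  intervalIntegral.integral_nonneg hr fun s _ => (psi_pos s).le

lemma PsiInt_le (hα : 0 < α) (hR : 0 < R) {r : ℝ} (hr : 0 ≤ r) : PsiInt α R r ≤ r := by
  have h := intervalIntegral.integral_mono_on (μ := volume) hr
    ((continuous_psi (α := α) hR).intervalIntegrable 0 r) (intervalIntegrable_const (c := (1 : ℝ)))
    fun s hs => psi_le_one hα hR hs.1
  simpa [PsiInt] using h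

lemma mul_psi_le_PsiInt (hα : 0 < α) (hR : 0 < R) {r : ℝ} (hr : 0 ≤ r) :
    r * psi α R r ≤ PsiInt α R r := by
  have h := intervalIntegral.integral_mono_on (μ := volume) hr
    (intervalIntegrable_const (c := psi α R r))
    ((continuous_psi (α := α) hR).intervalIntegrable 0 r)
    fun s hs => antitoneOn_psi hα hR hs.1 hr hs.2
  simpa [PsiInt] using h

/-- The integrand `μ Ψ / ψ` entering the definition of `nuf`. -/
noncomputable def nuIntegrand (α R r : ℝ) : ℝ := muf R r * PsiInt α R r / psi α R r

/-- The normalising constant in the definition of `nuf`. -/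
noncomputable def nuNorm (α R : ℝ) : ℝ := ∫ s in (0:ℝ)..(4 * R), nuIntegrand α R s

lemma continuous_nuIntegrand (hR : 0 < R) : Continuous (nuIntegrand α R) := by
  refine Continuous.div (Continuous.mul ?_ ?_) (continuous_psi hR) fun r => (psi_pos r).ne'
  · exact continuous_iff_continuousAt.2 fun r => (hasDerivAt_muf hR r).continuousAt
  · exact continuous_iff_continuousAt.2 fun r => (hasDerivAt_PsiInt hR r).continuousAt

lemma nuIntegrand_nonneg {r : ℝ} (hr : 0 ≤ r) : 0 ≤ nuIntegrand α R r :=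
  div_nonneg (mul_nonneg (muf_nonneg r) (PsiInt_nonneg hr)) (psi_pos r).le

lemma sq_div_two_le_nuNorm (hα : 0 < α) (hR : 0 < R) : R ^ 2 / 2 ≤ nuNorm α R := by
  have hi : ∀ a b, IntervalIntegrable (nuIntegrand α R) volume a b := fun a b =>
    (continuous_nuIntegrand hR).intervalIntegrable a b
  have h1 : ∫ s in (0:ℝ)..R, s ≤ ∫ s in (0:ℝ)..R, nuIntegrand α R s := by
    refine intervalIntegral.integral_mono_on hR.le (continuous_id.intervalIntegrable _ _) (hi _ _)
      fun s hs => ?_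
    rw [nuIntegrand, muf, if_pos hs.2, one_mul, le_div_iff₀ (psi_pos s)]
    exact mul_psi_le_PsiInt hα hR hs.1
  have h2 : 0 ≤ ∫ s in R..(4 * R), nuIntegrand α R s :=
    intervalIntegral.integral_nonneg (by linarith) fun s hs =>
      nuIntegrand_nonneg (hR.le.trans hs.1)
  rw [integral_id] at h1
  rw [nuNorm, ← intervalIntegral.integral_add_adjacent_intervals (hi 0 R) (hi R (4 * R))]
  linarith

lemma nuNorm_pos (hα : 0 < α) (hR : 0 < R) : 0 < nuNorm α R :=
  lt_of_lt_of_le (by positivity) (sq_div_two_le_nuNorm hα hR)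

lemma nuf_eq (r : ℝ) :
    nuf α R r = 1 - (1 / 2) * (∫ s in (0:ℝ)..r, nuIntegrand α R s) / nuNorm α R := rfl

lemma hasDerivAt_nuf (hR : 0 < R) (r : ℝ) :
    HasDerivAt (nuf α R) (-(nuIntegrand α R r / (2 * nuNorm α R))) r := by
  have h := (((continuous_nuIntegrand (α := α) hR).integral_hasStrictDerivAt 0 r).hasDerivAt)
  refine (((h.const_mul (1 / 2)).div_const (nuNorm α R)).const_sub 1).congr_deriv ?_
  ring

lemma nuf_le_one (hα : 0 < α) (hR : 0 < R) {r : ℝ} (hr : 0 ≤ r) : nuf α R r ≤ 1 := by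
  have h0 : 0 ≤ ∫ s in (0:ℝ)..r, nuIntegrand α R s :=
    intervalIntegral.integral_nonneg hr fun s hs => nuIntegrand_nonneg hs.1
  have hZ := nuNorm_pos hα hR
  rw [nuf_eq]
  have : 0 ≤ (1 / 2) * (∫ s in (0:ℝ)..r, nuIntegrand α R s) / nuNorm α R := by positivity
  linarith

lemma half_le_nuf (hα : 0 < α) (hR : 0 < R) {r : ℝ} (hr : 0 ≤ r) : 1 / 2 ≤ nuf α R r := by
  have hi : ∀ a b, IntervalIntegrable (nuIntegrand α R) volume a b := fun a b =>
    (continuous_nuIntegrand hR).intervalIntegrable a b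
  have hZ := nuNorm_pos hα hR
  have h : ∫ s in (0:ℝ)..r, nuIntegrand α R s ≤ nuNorm α R := by
    rw [nuNorm]
    rcases le_total r (4 * R) with h4 | h4
    · rw [← intervalIntegral.integral_add_adjacent_intervals (hi 0 r) (hi r (4 * R))]
      have : 0 ≤ ∫ s in r..(4 * R), nuIntegrand α R s :=
        intervalIntegral.integral_nonneg h4 fun s hs => nuIntegrand_nonneg (hr.trans hs.1)
      linarith
    · rw [← intervalIntegral.integral_add_adjacent_intervals (hi 0 (4 * R)) (hi (4 * R) r)]
      have : ∫ s in (4 * R)..r, nuIntegrand α R s = 0 := by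
        rw [intervalIntegral.integral_congr (g := fun _ => (0 : ℝ)) fun s hs => ?_]
        · simp
        · rw [Set.uIcc_of_le h4] at hs
          simp [nuIntegrand, muf_eq_zero hR hs.1]
      linarith
  rw [nuf_eq]
  have : (1 / 2) * (∫ s in (0:ℝ)..r, nuIntegrand α R s) / nuNorm α R ≤ 1 / 2 := by
    rw [div_le_iff₀ hZ]; linarith
  linarith

/-- The first derivative of `qf`. -/
noncomputable def qDeriv (α R r : ℝ) : ℝ := psi α R r * nuf α R r

/-- The second derivative of `qf`. -/
noncomputable def qDeriv2 (α R r : ℝ) : ℝ :=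
  -(α * tauDeriv R r) * (psi α R r * nuf α R r) - muf R r * PsiInt α R r / (2 * nuNorm α R)

/-- The third derivative of `qf`. -/
noncomputable def qDeriv3 (α R r : ℝ) : ℝ :=
  ((α * tauDeriv R r) ^ 2 - α * tauDeriv2 R r) * (psi α R r * nuf α R r)
    + α * tauDeriv R r * (muf R r * PsiInt α R r / (2 * nuNorm α R))
    - (mufDeriv R r * PsiInt α R r + muf R r * psi α R r) / (2 * nuNorm α R)

lemma hasDerivAt_qDeriv (hR : 0 < R) (r : ℝ) :
    HasDerivAt (qDeriv α R) (qDeriv2 α R r) r := by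
  refine ((hasDerivAt_psi hR r).mul (hasDerivAt_nuf hR r)).congr_deriv ?_
  have := (psi_pos (α := α) (R := R) r).ne'
  rw [qDeriv2, nuIntegrand]
  field_simp
  ring

lemma hasDerivAt_qf (hR : 0 < R) (r : ℝ) : HasDerivAt (qf α R) (qDeriv α R r) r :=
  ((continuous_iff_continuousAt.2 fun s =>
    (hasDerivAt_qDeriv (α := α) hR s).continuousAt).integral_hasStrictDerivAt 0 r).hasDerivAt

lemma hasDerivAt_qDeriv2 (hR : 0 < R) (r : ℝ) :
    HasDerivAt (qDeriv2 α R) (qDeriv3 α R r) r := by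
  refine ((((hasDerivAt_tauDeriv hR r).const_mul α).neg.mul (hasDerivAt_qDeriv hR r)).sub
    (((hasDerivAt_muf hR r).mul (hasDerivAt_PsiInt hR r)).div_const
      (2 * nuNorm α R))).congr_deriv ?_
  simp only [qDeriv3, qDeriv2, qDeriv]
  simp
  ring

lemma continuous_qDeriv3 (hR : 0 < R) : Continuous (qDeriv3 α R) := by
  have h1 : Continuous (tauDeriv R) :=
    continuous_iff_continuousAt.2 fun s => (hasDerivAt_tauDeriv hR s).continuousAt
  have h2 := continuous_tauDeriv2 hR
  have h3 : Continuous (muf R) :=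
    continuous_iff_continuousAt.2 fun s => (hasDerivAt_muf hR s).continuousAt
  have h4 := continuous_mufDeriv hR
  have h5 : Continuous (PsiInt α R) :=
    continuous_iff_continuousAt.2 fun s => (hasDerivAt_PsiInt hR s).continuousAt
  have h6 := continuous_psi (α := α) hR
  have h7 : Continuous (nuf α R) :=
    continuous_iff_continuousAt.2 fun s => (hasDerivAt_nuf hR s).continuousAt
  unfold qDeriv3
  fun_prop

lemma contDiff_qf (hR : 0 < R) : ContDiff ℝ 3 (qf α R) :=
  .of_hasDerivAt_succ (n := 2) (hasDerivAt_qf hR) <|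
    .of_hasDerivAt_succ (n := 1) (hasDerivAt_qDeriv hR) <|
    .of_hasDerivAt_succ (n := 0) (hasDerivAt_qDeriv2 hR) <|
    contDiff_zero.2 (continuous_qDeriv3 hR)

lemma qDeriv_nonneg (hα : 0 < α) (hR : 0 < R) {r : ℝ} (hr : 0 ≤ r) : 0 ≤ qDeriv α R r :=
  mul_nonneg (psi_pos r).le (by linarith [half_le_nuf hα hR hr])

lemma qDeriv_le_one (hα : 0 < α) (hR : 0 < R) {r : ℝ} (hr : 0 ≤ r) : qDeriv α R r ≤ 1 :=
  mul_le_one₀ (psi_le_one hα hR hr) (by linarith [half_le_nuf hα hR hr]) (nuf_le_one hα hR hr)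

lemma le_qDeriv (hα : 0 < α) (hR : 0 < R) {r : ℝ} (hr : 0 ≤ r) :
    1 / 2 * exp (-(7 * α * R ^ 2 / 3)) ≤ qDeriv α R r := by
  rw [mul_comm]
  exact mul_le_mul (le_psi hα hR hr) (half_le_nuf hα hR hr) (by norm_num) (psi_pos r).le

lemma muf_mul_PsiInt_div_le (hα : 0 < α) (hR : 0 < R) {r : ℝ} (hr : 0 ≤ r) :
    muf R r * PsiInt α R r / (2 * nuNorm α R) ≤ 2 / R := by
  have hZ := nuNorm_pos hα hR
  have h1 : muf R r * PsiInt α R r ≤ 2 * R :=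
    (mul_le_mul_of_nonneg_left (PsiInt_le hα hR hr) (muf_nonneg r)).trans (muf_mul_le hR hr)
  rw [div_le_div_iff₀ (by positivity) hR]
  nlinarith [sq_div_two_le_nuNorm hα hR]

lemma muf_mul_PsiInt_div_nonneg (hα : 0 < α) (hR : 0 < R) {r : ℝ} (hr : 0 ≤ r) :
    0 ≤ muf R r * PsiInt α R r / (2 * nuNorm α R) :=
  div_nonneg (mul_nonneg (muf_nonneg r) (PsiInt_nonneg hr)) (by linarith [nuNorm_pos hα hR])

lemma abs_qDeriv2_le (hα : 0 < α) (hR : 0 < R) {r : ℝ} (hr : 0 ≤ r) :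
    |qDeriv2 α R r| ≤ 2 * (α * R ^ 2 + 1) / R := by
  have hm := muf_mul_PsiInt_div_le hα hR hr
  have hm0 := muf_mul_PsiInt_div_nonneg hα hR hr
  have ht0 : 0 ≤ α * tauDeriv R r := mul_nonneg hα.le (tauDeriv_nonneg hR hr)
  have ht : α * tauDeriv R r ≤ α * (2 * R) := by gcongr; exact tauDeriv_le hR r
  have hq0 := qDeriv_nonneg hα hR hr
  have hq := qDeriv_le_one hα hR hr
  have hp : α * tauDeriv R r * qDeriv α R r ≤ α * (2 * R) * 1 := by gcongr
  have hp0 : 0 ≤ α * tauDeriv R r * qDeriv α R r := by positivity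
  have e : 2 * (α * R ^ 2 + 1) / R = α * (2 * R) * 1 + 2 / R := by field_simp
  rw [qDeriv2, ← qDeriv, e, abs_le]
  constructor <;> linarith

lemma abs_mufDeriv_mul_PsiInt_le (hα : 0 < α) (hR : 0 < R) {r : ℝ} (hr : 0 ≤ r) :
    |mufDeriv R r * PsiInt α R r| ≤ 3 := by
  rcases le_or_gt r (4 * R) with h | h
  · rw [abs_mul, abs_of_nonneg (PsiInt_nonneg hr)]
    have hpi := pi_pos
    calc _ ≤ π / (6 * R) * (4 * R) := by
          gcongr
          · exact PsiInt_nonneg hr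
          · exact abs_mufDeriv_le hR r
          · exact (PsiInt_le hα hR hr).trans h
      _ = π * (2 / 3) := by field_simp; ring
      _ ≤ 3 := by linarith [pi_lt_d2]
  · rw [mufDeriv, if_neg (by linarith), if_neg (by linarith)]
    norm_num

lemma abs_qDeriv3_le (hα : 0 < α) (hR : 0 < R) {r : ℝ} (hr : 0 ≤ r) :
    |qDeriv3 α R r| ≤ 4 * (α * R ^ 2 + 1) ^ 2 / R ^ 2 := by
  have hm := muf_mul_PsiInt_div_le hα hR hr
  have hm0 := muf_mul_PsiInt_div_nonneg hα hR hr
  have hZ := nuNorm_pos hα hR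
  have ht0 : 0 ≤ α * tauDeriv R r := mul_nonneg hα.le (tauDeriv_nonneg hR hr)
  have ht : α * tauDeriv R r ≤ α * (2 * R) := by gcongr; exact tauDeriv_le hR r
  have hq0 := qDeriv_nonneg hα hR hr
  have hq := qDeriv_le_one hα hR hr
  have a1 : |((α * tauDeriv R r) ^ 2 - α * tauDeriv2 R r) * qDeriv α R r| ≤
      (α * (2 * R)) ^ 2 + α := by
    rw [abs_mul, abs_of_nonneg hq0]
    refine (mul_le_of_le_one_right (abs_nonneg _) hq).trans ((abs_sub _ _).trans ?_)
    rw [abs_of_nonneg (sq_nonneg _), abs_mul, abs_of_pos hα]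
    have := mul_le_of_le_one_right hα.le (abs_tauDeriv2_le hR r)
    gcongr
  have a2 : |α * tauDeriv R r * (muf R r * PsiInt α R r / (2 * nuNorm α R))| ≤
      α * (2 * R) * (2 / R) := by
    rw [abs_of_nonneg (by positivity)]
    gcongr
  have a3 : |(mufDeriv R r * PsiInt α R r + muf R r * psi α R r) / (2 * nuNorm α R)| ≤
      4 / R ^ 2 := by
    rw [abs_div, abs_of_pos (by positivity : 0 < 2 * nuNorm α R)]
    have h1 : |muf R r * psi α R r| ≤ 1 := by
      rw [abs_of_nonneg (mul_nonneg (muf_nonneg r) (psi_pos r).le)]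
      exact mul_le_one₀ (muf_le_one r) (psi_pos r).le (psi_le_one hα hR hr)
    have h2 := abs_mufDeriv_mul_PsiInt_le hα hR hr
    have h3 := abs_add_le (mufDeriv R r * PsiInt α R r) (muf R r * psi α R r)
    have h4 := sq_div_two_le_nuNorm hα hR
    apply div_le_div₀ <;> first | positivity | linarith
  have e : 4 * (α * R ^ 2 + 1) ^ 2 / R ^ 2 =
      (α * (2 * R)) ^ 2 + α + α * (2 * R) * (2 / R) + 4 / R ^ 2 + 3 * α := by
    field_simp; ring
  rw [qDeriv3, ← qDeriv, e]
  refine (abs_sub _ _).trans ?_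
  have := abs_add_le (((α * tauDeriv R r) ^ 2 - α * tauDeriv2 R r) * qDeriv α R r)
    (α * tauDeriv R r * (muf R r * PsiInt α R r / (2 * nuNorm α R)))
  linarith

lemma qf_le (hα : 0 < α) (hR : 0 < R) {r : ℝ} (hr : 0 ≤ r) : qf α R r ≤ r := by
  have h := intervalIntegral.integral_mono_on (μ := volume) hr
    ((continuous_iff_continuousAt.2 fun s =>
      (hasDerivAt_qDeriv (α := α) hR s).continuousAt).intervalIntegrable 0 r)
    (intervalIntegrable_const (c := (1 : ℝ))) fun s hs => qDeriv_le_one hα hR hs.1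
  simpa [qf, qDeriv] using h

lemma le_qf (hα : 0 < α) (hR : 0 < R) {r : ℝ} (hr : 0 ≤ r) :
    1 / 2 * exp (-(7 * α * R ^ 2 / 3)) * r ≤ qf α R r := by
  have h := intervalIntegral.integral_mono_on (μ := volume) hr
    (intervalIntegrable_const (c := 1 / 2 * exp (-(7 * α * R ^ 2 / 3))))
    ((continuous_iff_continuousAt.2 fun s =>
      (hasDerivAt_qDeriv (α := α) hR s).continuousAt).intervalIntegrable 0 r)
    fun s hs => le_qDeriv hα hR hs.1
  rw [intervalIntegral.integral_const, smul_eq_mul, sub_zero, mul_comm] at h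
  exact h

end Profile

section Composite

variable {α R ε : ℝ}

lemma contDiffAt_ffun_and_norm_iteratedFDeriv_le {d : ℕ} {p p₁ p₂ p₃ : ℝ → ℝ}
    (hα : 0 < α) (hR : 0 < R) (hε : 0 < ε) (hεR : ε ≤ R / (4 * (α * R ^ 2 + 1)))
    (hp₁ : ∀ r, HasDerivAt p (p₁ r) r) (hp₂ : ∀ r, HasDerivAt p₁ (p₂ r) r)
    (hp₃ : ∀ r, HasDerivAt p₂ (p₃ r) r) (hp : ContDiff ℝ 3 p)
    {z : EuclideanSpace ℝ (Fin d)} (hz : ‖z‖ ≠ 0) (hh : hfun ε =ᶠ[nhds ‖z‖] p)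
    (b0 : 0 ≤ p ‖z‖) (b1 : 0 ≤ p₁ ‖z‖) (b1' : p₁ ‖z‖ ≤ 1) (b1'' : p₁ ‖z‖ ^ 2 ≤ ‖z‖ / ε)
    (b2 : |p₂ ‖z‖| ≤ 1 / ε) (b3 : |p₃ ‖z‖| ≤ 1 / ε ^ 2)
    (b12 : |p₂ ‖z‖ / ‖z‖ - p₁ ‖z‖ / ‖z‖ ^ 2| ≤ 1 / (2 * ε ^ 2)) :
    ContDiffAt ℝ 3 (ffun α R ε) z ∧ ‖iteratedFDeriv ℝ 3 (ffun α R ε) z‖ ≤ 9 / ε ^ 2 := by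
  have heq : (ffun α R ε : EuclideanSpace ℝ (Fin d) → ℝ) =ᶠ[nhds z]
      fun y => (qf α R ∘ p) ‖y‖ := by
    filter_upwards [continuous_norm.continuousAt.eventually hh] with y hy
    simp only [ffun, gfun, Function.comp]
    rw [hy]
  have hd1 : ∀ r, HasDerivAt (qf α R ∘ p) (qDeriv α R (p r) * p₁ r) r := fun r =>
    (hasDerivAt_qf hR (p r)).comp r (hp₁ r)
  have hd2 : ∀ r, HasDerivAt (fun r => qDeriv α R (p r) * p₁ r)
      (qDeriv2 α R (p r) * p₁ r ^ 2 + qDeriv α R (p r) * p₂ r) r := fun r =>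
    (((hasDerivAt_qDeriv hR (p r)).comp r (hp₁ r)).mul (hp₂ r)).congr_deriv (by simp; ring)
  have hd3 : ∀ r, HasDerivAt
      (fun r => qDeriv2 α R (p r) * p₁ r ^ 2 + qDeriv α R (p r) * p₂ r)
      (qDeriv3 α R (p r) * p₁ r ^ 3 + 3 * (qDeriv2 α R (p r) * (p₁ r * p₂ r))
        + qDeriv α R (p r) * p₃ r) r := fun r =>
    ((((hasDerivAt_qDeriv2 hR (p r)).comp r (hp₁ r)).mul ((hp₂ r).pow 2)).add
      (((hasDerivAt_qDeriv hR (p r)).comp r (hp₁ r)).mul (hp₃ r))).congr_deriv (by simp; ring)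
  obtain ⟨hc, hn⟩ := norm_iteratedFDeriv_three_radial_le hd1 hd2 hd3
    ((contDiff_qf hR).comp hp) (norm_ne_zero_iff.1 hz)
  refine ⟨hc.congr_of_eventuallyEq heq, ?_⟩
  rw [(heq.iteratedFDeriv ℝ 3).eq_of_nhds]
  refine hn.trans ?_
  have hr : 0 < ‖z‖ := lt_of_le_of_ne (norm_nonneg z) hz.symm
  have c1 := qDeriv_le_one hα hR b0
  have c0 := qDeriv_nonneg hα hR b0
  have hx : (α * R ^ 2 + 1) / R ≤ 1 / (4 * ε) := by
    rw [le_div_iff₀ (by positivity)] at hεR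
    rw [div_le_div_iff₀ hR (by positivity)]
    linarith
  have c2 : |qDeriv2 α R (p ‖z‖)| ≤ 1 / (2 * ε) := by
    refine (abs_qDeriv2_le hα hR b0).trans ?_
    calc _ = 2 * ((α * R ^ 2 + 1) / R) := by ring
      _ ≤ 2 * (1 / (4 * ε)) := by gcongr
      _ = _ := by field_simp; norm_num
  have c3 : |qDeriv3 α R (p ‖z‖)| ≤ 1 / (4 * ε ^ 2) := by
    refine (abs_qDeriv3_le hα hR b0).trans ?_
    calc _ = 4 * ((α * R ^ 2 + 1) / R) ^ 2 := by ring
      _ ≤ 4 * (1 / (4 * ε)) ^ 2 := by gcongr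
      _ = _ := by ring
  generalize qDeriv α R (p ‖z‖) = Q₁ at *
  generalize qDeriv2 α R (p ‖z‖) = Q₂ at *
  generalize qDeriv3 α R (p ‖z‖) = Q₃ at *
  generalize p₁ ‖z‖ = P₁ at *
  generalize p₂ ‖z‖ = P₂ at *
  generalize p₃ ‖z‖ = P₃ at *
  generalize ‖z‖ = r at *
  have e1 : |Q₃ * P₁ ^ 3| ≤ 1 / (4 * ε ^ 2) := by
    rw [abs_mul, abs_of_nonneg (pow_nonneg b1 3)]
    exact (mul_le_of_le_one_right (abs_nonneg _) (pow_le_one₀ b1 b1')).trans c3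
  have e2 : |3 * (Q₂ * (P₁ * P₂))| ≤ 3 * (1 / (2 * ε) * (1 * (1 / ε))) := by
    rw [abs_mul, abs_mul, abs_mul, abs_of_nonneg b1, abs_of_pos (by norm_num : (0 : ℝ) < 3)]
    gcongr
  have e3 : |Q₁ * P₃| ≤ 1 / ε ^ 2 := by
    rw [abs_mul, abs_of_nonneg c0]
    exact (mul_le_of_le_one_left (abs_nonneg _) c1).trans b3
  have e4 : |Q₂ * P₁ ^ 2 / r| ≤ 1 / (2 * ε) * (r / ε) / r := by
    rw [abs_div, abs_mul, abs_of_nonneg (sq_nonneg P₁), abs_of_pos hr]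
    gcongr
  have e5 : |Q₁ * (P₂ / r - P₁ / r ^ 2)| ≤ 1 / (2 * ε ^ 2) := by
    rw [abs_mul, abs_of_nonneg c0]
    exact (mul_le_of_le_one_left (abs_nonneg _) c1).trans b12
  have e6 : (Q₂ * P₁ ^ 2 + Q₁ * P₂) / r - Q₁ * P₁ / r ^ 2 =
      Q₂ * P₁ ^ 2 / r + Q₁ * (P₂ / r - P₁ / r ^ 2) := by ring
  rw [e6]
  calc _ ≤ (1 / (4 * ε ^ 2) + 3 * (1 / (2 * ε) * (1 * (1 / ε))) + 1 / ε ^ 2)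
        + 6 * (1 / (2 * ε) * (r / ε) / r + 1 / (2 * ε ^ 2)) := by
        gcongr
        · exact (abs_add_three _ _ _).trans (by gcongr)
        · exact (abs_add_le _ _).trans (by gcongr)
    _ = (35 / 4) / ε ^ 2 := by field_simp; norm_num
    _ ≤ 9 / ε ^ 2 := by gcongr; norm_num

lemma hfun_le (hε : 0 < ε) {r : ℝ} (hr : 0 ≤ r) : hfun ε r ≤ r := by
  unfold hfun
  split_ifs with h1 h2
  · rw [div_le_iff₀ (by positivity)]
    nlinarith [mul_nonneg hr (sub_nonneg.2 h1), mul_nonneg hr hε.le]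
  · obtain ⟨u, rfl⟩ : ∃ u, r = ε * (1 + u) := ⟨r / ε - 1, by field_simp; ring⟩
    have hu : 0 < u := by nlinarith
    have hu1 : u ≤ 1 := by nlinarith
    rw [show ε / 6 + (ε * (1 + u) - ε) / 2 + (ε * (1 + u) - ε) ^ 2 / (2 * ε)
      - (ε * (1 + u) - ε) ^ 3 / (6 * ε ^ 2) = ε * (1 / 6 + u / 2 + u ^ 2 / 2 - u ^ 3 / 6) by
      field_simp; ring]
    gcongr
    nlinarith [pow_pos hu 3]
  · exact le_rfl

lemma hfun_nonneg (hε : 0 < ε) {r : ℝ} (hr : 0 ≤ r) : 0 ≤ hfun ε r := by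
  unfold hfun
  split_ifs with h1 h2
  · positivity
  · have h0 : 0 ≤ r - ε := by linarith
    have : (r - ε) ^ 3 / (6 * ε ^ 2) ≤ (r - ε) / 6 := by
      rw [div_le_iff₀ (by positivity)]
      nlinarith [mul_nonneg h0 (mul_nonneg (by linarith : 0 ≤ ε - (r - ε)) (by linarith : 0 ≤ ε + (r - ε)))]
    have : 0 ≤ (r - ε) ^ 2 / (2 * ε) := by positivity
    linarith
  · exact hr

lemma sub_le_hfun (hε : 0 < ε) {r : ℝ} (hr : 0 ≤ r) : r - 2 * ε ≤ hfun ε r := by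
  rcases le_or_gt r (2 * ε) with h | h
  · linarith [hfun_nonneg hε hr]
  · rw [hfun, if_neg (by linarith), if_neg (by linarith)]
    linarith

end Composite

theorem f_third_deriv_and_bounds (d : ℕ) (hd : 1 ≤ d) (α R ε : ℝ)
    (hα : 0 < α) (hR : 0 < R) (hε : 0 < ε)
    (hεR : ε ≤ R / (4 * (α * R ^ 2 + 1))) :
    (∀ z : EuclideanSpace ℝ (Fin d), ‖z‖ ≠ 0 → ‖z‖ ≠ ε → ‖z‖ ≠ 2 * ε →
      ContDiffAt ℝ 3 (ffun α R ε) z ∧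
      ‖iteratedFDeriv ℝ 3 (ffun α R ε) z‖ ≤ 9 / ε ^ 2) ∧
    (∀ z : EuclideanSpace ℝ (Fin d),
      1 / 2 * Real.exp (-(7 * α * R ^ 2 / 3)) * (‖z‖ - 2 * ε) ≤ ffun α R ε z ∧
      ffun α R ε z ≤ ‖z‖) := by
  refine ⟨fun z hz0 hz1 hz2 => ?_, fun z => ?_⟩
  · have hr : 0 < ‖z‖ := lt_of_le_of_ne (norm_nonneg z) hz0.symm
    rcases lt_or_gt_of_ne hz1 with h | h
    · refine contDiffAt_ffun_and_norm_iteratedFDeriv_le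
        (p := fun r => r ^ 3 / (6 * ε ^ 2)) (p₁ := fun r => r ^ 2 / (2 * ε ^ 2))
        (p₂ := fun r => r / ε ^ 2) (p₃ := fun _ => 1 / ε ^ 2) hα hR hε hεR
        (fun r => ((hasDerivAt_pow 3 r).div_const _).congr_deriv (by norm_num; field_simp; ring))
        (fun r => ((hasDerivAt_pow 2 r).div_const _).congr_deriv (by norm_num; field_simp))
        (fun r => (hasDerivAt_id r).div_const _) (by fun_prop) hz0 ?_ ?_ ?_ ?_ ?_ ?_ ?_ ?_
      · filter_upwards [Iio_mem_nhds h] with r hr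
        rw [hfun, if_pos (le_of_lt hr)]
      · positivity
      · positivity
      · rw [div_le_one (by positivity)]; nlinarith
      · obtain ⟨t, ht⟩ : ∃ t, ‖z‖ = ε * t := ⟨‖z‖ / ε, by field_simp⟩
        rw [ht] at hr h ⊢
        have ht0 : 0 < t := by nlinarith
        have ht1 : t ≤ 1 := by nlinarith
        rw [show ((ε * t) ^ 2 / (2 * ε ^ 2)) ^ 2 = t * (t ^ 3 / 4) by field_simp; norm_num,
          show ε * t / ε = t by field_simp]
        have : t ^ 3 ≤ 1 := pow_le_one₀ ht0.le ht1
        exact mul_le_of_le_one_right ht0.le (by linarith)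
      · rw [abs_of_nonneg (by positivity), div_le_div_iff₀ (by positivity) hε]; nlinarith
      · rw [abs_of_nonneg (by positivity)]
      · refine (abs_of_nonneg ?_).trans_le ?_ <;> field_simp <;> norm_num
    · rcases lt_or_gt_of_ne hz2 with h2 | h2
      · have hs : ∀ r, HasDerivAt (fun s => s - ε) 1 r := fun r => (hasDerivAt_id r).sub_const ε
        have hden : 0 < ε ^ 2 := by positivity
        obtain ⟨u, hu⟩ : ∃ u, ‖z‖ = ε * (1 + u) := ⟨‖z‖ / ε - 1, by field_simp; ring⟩
        have hu0 : 0 < u := by rw [hu] at h; nlinarith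
        have hu1 : u < 1 := by rw [hu] at h2; nlinarith
        have hp₁ : 1 / 2 + (‖z‖ - ε) / ε - (‖z‖ - ε) ^ 2 / (2 * ε ^ 2) = 1 / 2 + u - u ^ 2 / 2 := by
          rw [hu]; field_simp; ring
        have hp₂ : 1 / ε - (‖z‖ - ε) / ε ^ 2 = (1 - u) / ε := by
          rw [hu]; field_simp; ring
        refine contDiffAt_ffun_and_norm_iteratedFDeriv_le
          (p := fun r => ε / 6 + (r - ε) / 2 + (r - ε) ^ 2 / (2 * ε) - (r - ε) ^ 3 / (6 * ε ^ 2))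
          (p₁ := fun r => 1 / 2 + (r - ε) / ε - (r - ε) ^ 2 / (2 * ε ^ 2))
          (p₂ := fun r => 1 / ε - (r - ε) / ε ^ 2) (p₃ := fun _ => -(1 / ε ^ 2)) hα hR hε hεR
          (fun r => (((((hs r).div_const 2).const_add (ε / 6)).add
            (((hs r).pow 2).div_const (2 * ε))).sub
            (((hs r).pow 3).div_const (6 * ε ^ 2))).congr_deriv (by simp; field_simp; ring))
          (fun r => ((((hs r).div_const ε).const_add (1 / 2)).sub
            (((hs r).pow 2).div_const (2 * ε ^ 2))).congr_deriv (by simp; field_simp))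
          (fun r => ((hs r).div_const (ε ^ 2)).const_sub (1 / ε)) (by fun_prop) hz0
          ?_ ?_ ?_ ?_ ?_ ?_ ?_ ?_
        · filter_upwards [Ioo_mem_nhds h h2] with r hr
          rw [hfun, if_neg (not_le.2 hr.1), if_pos hr.2.le]
        · have := hfun_nonneg hε hr.le
          rwa [hfun, if_neg (not_le.2 h), if_pos h2.le] at this
        · simp only [hp₁]; nlinarith
        · simp only [hp₁]; nlinarith
        · simp only [hp₁]
          have : (1 / 2 + u - u ^ 2 / 2) ^ 2 ≤ 1 := pow_le_one₀ (by nlinarith) (by nlinarith)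
          refine this.trans ?_
          rw [one_le_div hε]; exact h.le
        · simp only [hp₂]
          rw [abs_of_nonneg (div_nonneg (by linarith) hε.le)]
          gcongr; linarith
        · rw [abs_neg, abs_of_nonneg (by positivity)]
        · simp only [hp₁, hp₂]
          rw [hu, show (1 - u) / ε / (ε * (1 + u)) - (1 / 2 + u - u ^ 2 / 2) / (ε * (1 + u)) ^ 2 =
            ((1 / 2 - u - u ^ 2 / 2) / (1 + u) ^ 2) / ε ^ 2 by field_simp; ring,
            show 1 / (2 * ε ^ 2) = (1 / 2) / ε ^ 2 by field_simp, abs_div, abs_of_pos hden]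
          gcongr
          rw [abs_div, abs_of_pos (by positivity : 0 < (1 + u) ^ 2), div_le_iff₀ (by positivity),
            abs_le]
          constructor <;> nlinarith
      · refine contDiffAt_ffun_and_norm_iteratedFDeriv_le
          (p := fun r => r) (p₁ := fun _ => 1) (p₂ := fun _ => 0) (p₃ := fun _ => 0) hα hR hε hεR
          (fun r => hasDerivAt_id r) (fun r => hasDerivAt_const _ _)
          (fun r => hasDerivAt_const _ _) (by fun_prop) hz0 ?_ hr.le (by norm_num) (by norm_num)
          ?_ ?_ ?_ ?_
        · filter_upwards [Ioi_mem_nhds h2] with r hr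
          have hr' : 2 * ε < r := hr
          rw [hfun, if_neg (by linarith), if_neg (by linarith)]
        · rw [one_pow, one_le_div hε]; exact h.le
        · rw [abs_zero]; positivity
        · rw [abs_zero]; positivity
        · rw [zero_div, zero_sub, abs_neg, abs_of_nonneg (by positivity)]
          gcongr
          nlinarith
  · have h0 := hfun_nonneg hε (norm_nonneg z)
    refine ⟨?_, (qf_le hα hR h0).trans (hfun_le hε (norm_nonneg z))⟩
    refine le_trans ?_ (le_qf hα hR h0)
    gcongr
    exact sub_le_hfun hε (norm_nonneg z)
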